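/- arXiv:1103.1949 — 2 statements merged into one kernel-verified Lean document; each statement's English description precedes it below -/
import Mathlib

section
/- For every natural number j, φ(A_{j+1}/A_j) < 2/3, and the sequence φ(A_{j+1}/A_j) converges to 2/3 = φ(2 + √3) as j → ∞. -/
open Finset

/-- λ = 2 + √3 -/
noncomputable def lam : ℝ := 2 + Real.sqrt 3

/-- A_k = (λ^k + λ^{-k}) / 2 -/
noncomputable def A (k : ℕ) : ℝ := (lam ^ k + lam⁻¹ ^ k) / 2

/-- B_k = (λ^k - λ^{-k}) / (2√3) -/
noncomputable def B (k : ℕ) : ℝ := (lam ^ k - lam⁻¹ ^ k) / (2 * Real.sqrt 3)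

/-- φ(t) = (1 + t²)/(1 + t)² -/
noncomputable def phi (t : ℝ) : ℝ := (1 + t ^ 2) / (1 + t) ^ 2

/-- g_k(n) = (1/B_n)·(A_{n-k}·Σ_{j<k}(A_{j+1}+A_j)φ(A_{j+1}/A_j)
              + A_k·Σ_{j<n-k}(A_{j+1}+A_j)φ(A_{j+1}/A_j)) -/
noncomputable def g (k n : ℕ) : ℝ :=
  (1 / B n) *
    (A (n - k) * ∑ j ∈ Finset.range k, (A (j + 1) + A j) * phi (A (j + 1) / A j)
      + A k * ∑ j ∈ Finset.range (n - k), (A (j + 1) + A j) * phi (A (j + 1) / A j))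

theorem lam_inv : lam⁻¹ = 2 - √3 := by
  have h : (√3) ^ 2 = 3 := Real.sq_sqrt (by norm_num)
  refine inv_eq_of_mul_eq_one_right ?_
  unfold lam
  linear_combination -h

theorem one_lt_lam : 1 < lam := by
  unfold lam
  linarith [Real.sqrt_nonneg 3]

theorem lam_inv_pow_pos (j : ℕ) : 0 < lam⁻¹ ^ j :=
  pow_pos (inv_pos.2 (zero_lt_one.trans one_lt_lam)) j

theorem half_le_A (j : ℕ) : 1 / 2 ≤ A j := by
  have h : 1 ≤ lam ^ j := one_le_pow₀ one_lt_lam.le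
  unfold A
  linarith [lam_inv_pow_pos j]

theorem A_pos (j : ℕ) : 0 < A j := by linarith [half_le_A j]

theorem A_succ_eq_lam_mul_sub (j : ℕ) : A (j + 1) = lam * A j - √3 * lam⁻¹ ^ j := by
  have h : lam⁻¹ = lam - 2 * √3 := by rw [lam_inv, lam]; ring
  unfold A
  rw [pow_succ lam, pow_succ lam⁻¹]
  linear_combination lam⁻¹ ^ j / 2 * h

theorem A_succ_eq_lam_inv_mul_add (j : ℕ) : A (j + 1) = lam⁻¹ * A j + √3 * lam ^ j := by
  have h : lam⁻¹ = lam - 2 * √3 := by rw [lam_inv, lam]; ring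
  unfold A
  rw [pow_succ lam, pow_succ lam⁻¹]
  linear_combination -lam ^ j / 2 * h

theorem A_succ_div_lt_lam (j : ℕ) : A (j + 1) / A j < lam := by
  rw [div_lt_iff₀ (A_pos j), A_succ_eq_lam_mul_sub]
  linarith [mul_pos (Real.sqrt_pos.2 (zero_lt_three (α := ℝ))) (lam_inv_pow_pos j)]

theorem lam_inv_lt_A_succ_div (j : ℕ) : lam⁻¹ < A (j + 1) / A j := by
  rw [lt_div_iff₀ (A_pos j), A_succ_eq_lam_inv_mul_add]
  linarith [mul_pos (Real.sqrt_pos.2 (zero_lt_three (α := ℝ)))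
    (pow_pos (zero_lt_one.trans one_lt_lam) j)]

theorem phi_lt_two_thirds {t : ℝ} (h₁ : lam⁻¹ < t) (h₂ : t < lam) : phi t < 2 / 3 := by
  have ht : 0 < t := (inv_pos.2 (zero_lt_one.trans one_lt_lam)).trans h₁
  have h : (√3) ^ 2 = 3 := Real.sq_sqrt (by norm_num)
  rw [lam_inv] at h₁
  unfold lam at h₂
  unfold phi
  rw [div_lt_iff₀ (by positivity)]
  nlinarith [mul_pos (sub_pos.2 h₁) (sub_pos.2 h₂)]

theorem phi_lam : phi lam = 2 / 3 := by
  have h : (√3) ^ 2 = 3 := Real.sq_sqrt (by norm_num)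
  have h0 : 1 + lam ≠ 0 := by linarith [one_lt_lam]
  rw [phi, div_eq_iff (pow_ne_zero 2 h0), lam]
  linear_combination h / 3

theorem continuousAt_phi {t : ℝ} (ht : 1 + t ≠ 0) : ContinuousAt phi t := by
  unfold phi
  exact ContinuousAt.div (by fun_prop) (by fun_prop) (pow_ne_zero 2 ht)

theorem tendsto_A_succ_div :
    Filter.Tendsto (fun j : ℕ => A (j + 1) / A j) Filter.atTop (nhds lam) := by
  have h0 : Filter.Tendsto (fun j : ℕ => lam⁻¹ ^ j) Filter.atTop (nhds 0) :=
    tendsto_pow_atTop_nhds_zero_of_lt_one (inv_pos.2 (zero_lt_one.trans one_lt_lam)).le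
      (inv_lt_one_of_one_lt₀ one_lt_lam)
  have h1 : Filter.Tendsto (fun j : ℕ => lam - 2 * √3 * lam⁻¹ ^ j) Filter.atTop (nhds lam) := by
    simpa using (h0.const_mul (2 * √3)).const_sub lam
  refine tendsto_of_tendsto_of_tendsto_of_le_of_le h1 tendsto_const_nhds (fun j => ?_)
    fun j => (A_succ_div_lt_lam j).le
  have h2 : 0 ≤ √3 * lam⁻¹ ^ j := mul_nonneg (Real.sqrt_nonneg 3) (lam_inv_pow_pos j).le
  dsimp only
  rw [le_div_iff₀ (A_pos j), A_succ_eq_lam_mul_sub]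
  nlinarith [mul_nonneg h2 (sub_nonneg.2 (half_le_A j))]

theorem phi_ratio_lt_and_tendsto :
    (∀ j : ℕ, phi (A (j + 1) / A j) < 2 / 3) ∧
    Filter.Tendsto (fun j : ℕ => phi (A (j + 1) / A j)) Filter.atTop (nhds (2 / 3)) ∧
    phi (2 + Real.sqrt 3) = 2 / 3 := by
  exact ⟨fun j => phi_lt_two_thirds (lam_inv_lt_A_succ_div j) (A_succ_div_lt_lam j),
    phi_lam ▸ (continuousAt_phi (by linarith [one_lt_lam])).tendsto.comp tendsto_A_succ_div,
    phi_lam⟩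
end

section
/- For every natural number n ≥ 1 and every natural number k with 1 ≤ k ≤ ⌊n/2⌋, g_0(n) ≥ g_k(n). -/
open Finset

theorem A_zero : A 0 = 1 := by
  simp [A]

theorem B_zero : B 0 = 0 := by
  simp [B]

theorem A_succ (k : ℕ) : A (k + 1) = 2 * A k + 3 * B k := by
  have h : √3 ^ 2 = 3 := Real.sq_sqrt (by norm_num)
  have h0 : √3 ≠ 0 := by positivity
  unfold A B
  rw [lam_inv, pow_succ, pow_succ, lam]
  field_simp
  linear_combination ((2 + √3) ^ k - (2 - √3) ^ k) * h

theorem B_succ (k : ℕ) : B (k + 1) = A k + 2 * B k := by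
  have h0 : √3 ≠ 0 := by positivity
  unfold A B
  rw [lam_inv, pow_succ, pow_succ, lam]
  field_simp
  ring

theorem A_sq_sub_three_mul_B_sq (k : ℕ) : A k ^ 2 - 3 * B k ^ 2 = 1 := by
  induction k with
  | zero => simp [A_zero, B_zero]
  | succ k ih =>
    rw [A_succ, B_succ]
    linear_combination ih

theorem A_B_lower (k : ℕ) : 1 ≤ A k ∧ 0 ≤ B k := by
  induction k with
  | zero => simp [A_zero, B_zero]
  | succ k ih =>
    rw [A_succ, B_succ]
    constructor <;> linarith [ih.1, ih.2]

theorem two_le_A {k : ℕ} (hk : 1 ≤ k) : 2 ≤ A k := by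
  obtain ⟨j, rfl⟩ := Nat.exists_eq_add_of_le' hk
  rw [A_succ]
  linarith [(A_B_lower j).1, (A_B_lower j).2]

theorem three_pow_le_A_add_B (k : ℕ) : 3 ^ k ≤ A k + B k := by
  induction k with
  | zero => simp [A_zero, B_zero]
  | succ k ih =>
    rw [A_succ, B_succ, pow_succ]
    linarith [(A_B_lower k).2]

theorem A_B_add (k m : ℕ) :
    A (k + m) = A k * A m + 3 * (B k * B m) ∧ B (k + m) = A m * B k + A k * B m := by
  induction m with
  | zero => simp [A_zero, B_zero]
  | succ m ih =>
    rw [← add_assoc, A_succ (k + m), B_succ (k + m), A_succ m, B_succ m, ih.1, ih.2]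
    constructor <;> ring

/-- The partial sums differ from `2 * B n` by a rapidly convergent series. -/
theorem sum_phi_eq (n : ℕ) :
    ∑ j ∈ range n, (A (j + 1) + A j) * phi (A (j + 1) / A j) =
      2 * B n - ∑ j ∈ range n, 1 / (3 * (A j + B j)) := by
  induction n with
  | zero => simp [B_zero]
  | succ n ih =>
    rw [sum_range_succ, sum_range_succ, ih, B_succ, A_succ, phi]
    obtain ⟨ha, hb⟩ := A_B_lower n
    have h := A_sq_sub_three_mul_B_sq n
    generalize A n = a at *
    generalize B n = b at *
    have ha0 : a ≠ 0 := by positivity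
    have hab : a + b ≠ 0 := by positivity
    have e : (2 * a + 3 * b + a) * ((1 + ((2 * a + 3 * b) / a) ^ 2) /
        (1 + (2 * a + 3 * b) / a) ^ 2) = (5 * a ^ 2 + 12 * a * b + 9 * b ^ 2) / (3 * (a + b)) := by
      have h1 : 1 + (2 * a + 3 * b) / a = 3 * (a + b) / a := by
        field_simp
        ring
      rw [h1]
      field_simp
      ring
    rw [e]
    field_simp
    linear_combination -h

theorem sum_inv_le (n : ℕ) : ∑ j ∈ range n, 1 / (3 * (A j + B j)) ≤ 1 / 2 := by
  suffices h : ∑ j ∈ range n, 1 / (3 * (A j + B j)) ≤ 1 / 2 - 1 / (2 * 3 ^ n) by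
    have : (0 : ℝ) < 1 / (2 * 3 ^ n) := by positivity
    linarith
  induction n with
  | zero => simp
  | succ n ih =>
    rw [sum_range_succ]
    have h : 1 / (3 * (A n + B n)) ≤ 1 / (3 * 3 ^ n) := by
      have := three_pow_le_A_add_B n
      gcongr
    have e : (1 : ℝ) / (2 * 3 ^ n) = 1 / (3 * 3 ^ n) + 1 / (2 * 3 ^ (n + 1)) := by
      rw [pow_succ]
      field_simp
      norm_num
    linarith

theorem third_le_sum_inv {n : ℕ} (hn : 1 ≤ n) :
    1 / 3 ≤ ∑ j ∈ range n, 1 / (3 * (A j + B j)) := by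
  obtain ⟨m, rfl⟩ := Nat.exists_eq_add_of_le' hn
  rw [sum_range_succ', A_zero, B_zero]
  have : 0 ≤ ∑ j ∈ range m, 1 / (3 * (A (j + 1) + B (j + 1))) :=
    sum_nonneg fun j _ => by
      have := A_B_lower (j + 1)
      have : 0 ≤ A (j + 1) + B (j + 1) := by linarith
      positivity
  norm_num at this ⊢
  exact this

theorem g_zero_ge_g_k (n k : ℕ) (hn : 1 ≤ n) (hk1 : 1 ≤ k) (hk2 : k ≤ n / 2) :
    g 0 n ≥ g k n := by
  obtain ⟨m, rfl⟩ := Nat.exists_eq_add_of_le (show k ≤ n by omega)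
  have hm : 1 ≤ m := by omega
  unfold g
  rw [ge_iff_le, Nat.add_sub_cancel_left, Nat.sub_zero, sum_phi_eq, sum_phi_eq, sum_phi_eq,
    sum_phi_eq]
  have hB : 0 ≤ 1 / B (k + m) := one_div_nonneg.2 (A_B_lower _).2
  refine mul_le_mul_of_nonneg_left ?_ hB
  rw [A_zero, B_zero, sum_range_zero, (A_B_add k m).2]
  have h1 := sum_inv_le (k + m)
  have h2 := mul_le_mul (two_le_A hm) (third_le_sum_inv hk1) (by norm_num)
    (by linarith [two_le_A hm])
  have h3 := mul_le_mul (two_le_A hk1) (third_le_sum_inv hm) (by norm_num)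
    (by linarith [two_le_A hk1])
  linarith
end
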